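/- arXiv:1703.08508 — 2 statements merged into one kernel-verified Lean document; each statement's English description precedes it below -/
import Mathlib

section
/- The classical value of the Mermin–Peres Magic Square game equals 8/9; in particular, it is strictly less than 1. -/
/-- A triple of bits has even parity. -/
def evenPar (a : Fin 3 → Bool) : Prop := xor (a 0) (xor (a 1) (a 2)) = false

/-- A triple of bits has odd parity. -/
def oddPar (b : Fin 3 → Bool) : Prop := xor (b 0) (xor (b 1) (b 2)) = true

/-- The winning probability in the Magic Square game (uniform input distribution on
`Fin 3 × Fin 3`) of the deterministic strategy in which on input `x` Alice assigns the
bit `A x j` to entry `j` of row `x`, and on input `y` Bob assigns the bit `B y i` to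
entry `i` of column `y`; the players win iff `A x y = B y x`. -/
noncomputable def msClassicalScore (A B : Fin 3 → Fin 3 → Bool) : ℝ :=
  (∑ x : Fin 3, ∑ y : Fin 3, if A x y = B y x then (1 : ℝ) else 0) / 9

/-- The classical value of the Mermin–Peres Magic Square game is exactly `8/9`;
in particular it is strictly less than `1`. -/
theorem ms_classical_value :
    IsGreatest
      { v : ℝ | ∃ A B : Fin 3 → Fin 3 → Bool,
          (∀ x, evenPar (A x)) ∧ (∀ y, oddPar (B y)) ∧ v = msClassicalScore A B }
      (8 / 9) ∧ (8 / 9 : ℝ) < 1 := by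
  refine ⟨⟨⟨fun x y => decide (x = 0 ∧ y ≠ 2), fun _ x => decide (x = 0), ?_, ?_, ?_⟩, ?_⟩,
    by norm_num⟩
  · unfold evenPar; decide
  · unfold oddPar; decide
  · simp [msClassicalScore, Fin.sum_univ_three, -Finset.sum_boole]
    norm_num
  · rintro v ⟨A, B, hA, hB, rfl⟩
    -- perfect agreement contradicts the parity constraints
    have hne : ∃ x y, A x y ≠ B y x := by
      by_contra! h
      have a0 := hA 0
      have a1 := hA 1
      have a2 := hA 2
      have b0 := hB 0
      have b1 := hB 1
      have b2 := hB 2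
      simp only [evenPar, oddPar, h] at a0 a1 a2 b0 b1 b2
      clear hA hB h
      generalize B 0 0 = p at *
      generalize B 0 1 = q at *
      generalize B 0 2 = r at *
      generalize B 1 0 = s at *
      generalize B 1 1 = t at *
      generalize B 1 2 = u at *
      generalize B 2 0 = v at *
      generalize B 2 1 = w at *
      generalize B 2 2 = z at *
      cases p <;> cases q <;> cases r <;> cases s <;> cases t <;> cases u <;> simp_all
    obtain ⟨x, y, hxy⟩ := hne
    have hle : ∀ i j, (if A i j = B j i then (1 : ℝ) else 0) ≤ if i = x ∧ j = y then 0 else 1 := by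
      intro i j
      by_cases hij : i = x ∧ j = y
      · obtain ⟨rfl, rfl⟩ := hij
        simp [hxy]
      · simp only [hij, if_false]
        split_ifs <;> norm_num
    have hsum := Finset.sum_le_sum fun i (_ : i ∈ Finset.univ) =>
      Finset.sum_le_sum fun j (_ : j ∈ Finset.univ) => hle i j
    have h8 : (∑ i : Fin 3, ∑ j : Fin 3, if i = x ∧ j = y then (0 : ℝ) else 1) = 8 := by
      clear hsum hle hxy
      fin_cases x <;> fin_cases y <;> simp [Fin.sum_univ_three] <;> norm_num
    unfold msClassicalScore
    linarith
end

section
/- The entangled value of the Mermin–Peres Magic Square game equals 1: there exist finite dimensions d_A, d_B, a unit vector ψ ∈ ℂ^{d_A} ⊗ ℂ^{d_B}, and POVMs {A^x_a}_{a} on ℂ^{d_A} for each x and {B^y_b}_{b} on ℂ^{d_B} for each y, such that Σ_{x,y} π(x,y) Σ_{a,b} V(a,b,x,y) ⟨ψ| A^x_a ⊗ B^y_b |ψ⟩ = 1. -/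
open Matrix
open scoped Kronecker ComplexOrder

/-- Alice's output set in the Magic Square game: triples of bits with even parity. -/
abbrev EvenT : Type := {a : Fin 3 → Bool // xor (a 0) (xor (a 1) (a 2)) = false}

/-- Bob's output set in the Magic Square game: triples of bits with odd parity. -/
abbrev OddT : Type := {b : Fin 3 → Bool // xor (b 0) (xor (b 1) (b 2)) = true}

/-- The magic square of (real) observables, signs chosen so rows multiply to `1` and
columns to `-1`. -/
def msObs : Fin 3 → Fin 3 → Fin 4 → Fin 4 → ℤ :=
  ![![![![0,0,-1,0],![0,0,0,-1],![-1,0,0,0],![0,-1,0,0]],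
      ![![0,-1,0,0],![-1,0,0,0],![0,0,0,-1],![0,0,-1,0]],
      ![![0,0,0,1],![0,0,1,0],![0,1,0,0],![1,0,0,0]]],
    ![![![1,0,0,0],![0,-1,0,0],![0,0,1,0],![0,0,0,-1]],
      ![![1,0,0,0],![0,1,0,0],![0,0,-1,0],![0,0,0,-1]],
      ![![1,0,0,0],![0,-1,0,0],![0,0,-1,0],![0,0,0,1]]],
    ![![![0,0,1,0],![0,0,0,-1],![1,0,0,0],![0,-1,0,0]],
      ![![0,1,0,0],![1,0,0,0],![0,0,0,-1],![0,0,-1,0]],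
      ![![0,0,0,-1],![0,0,1,0],![0,1,0,0],![-1,0,0,0]]]]

/-- Sign of a bit. -/
def msSgn (c : Bool) : ℤ := if c then -1 else 1

/-- Four times Alice's projector. -/
def msN (x : Fin 3) (a : EvenT) : Matrix (Fin 4) (Fin 4) ℤ := fun i j =>
  (if i = j then 1 else 0) + msSgn (a.1 0) * msObs x 0 i j + msSgn (a.1 1) * msObs x 1 i j
    + msSgn (a.1 2) * msObs x 2 i j

/-- Four times Bob's projector. -/
def msK (y : Fin 3) (b : OddT) : Matrix (Fin 4) (Fin 4) ℤ := fun i j =>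
  (if i = j then 1 else 0) + msSgn (b.1 0) * msObs 0 y i j + msSgn (b.1 1) * msObs 1 y i j
    + msSgn (b.1 2) * msObs 2 y i j

/-- Rescaled complex version of an integer matrix. -/
noncomputable def msC (N : Matrix (Fin 4) (Fin 4) ℤ) : Matrix (Fin 4) (Fin 4) ℂ :=
  fun i j => (1 / 4 : ℂ) * (N i j : ℂ)

theorem msC_psd (N : Matrix (Fin 4) (Fin 4) ℤ)
    (h : ∀ i j, ∑ k, N k i * N k j = 4 * N i j) : (msC N).PosSemidef := by
  have e : msC N = (msC N)ᴴ * msC N := by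
    ext i j
    have h1 : ∑ k, (N k i : ℂ) * (N k j : ℂ) = 4 * (N i j : ℂ) := by exact_mod_cast h i j
    rw [Matrix.mul_apply]
    simp only [msC, conjTranspose_apply, star_mul', star_div₀, star_one, star_ofNat, star_intCast]
    have h2 : ∀ k, (1 / 4 : ℂ) * (N k i : ℂ) * (1 / 4 * (N k j : ℂ))
        = 1 / 16 * ((N k i : ℂ) * (N k j : ℂ)) := fun k => by ring
    simp only [h2]
    rw [← Finset.mul_sum, h1]
    ring
  rw [e]
  exact posSemidef_conjTranspose_mul_self _

theorem msC_sum {ι : Type} [Fintype ι] (N : ι → Matrix (Fin 4) (Fin 4) ℤ)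
    (h : ∀ i j, ∑ a, N a i j = if i = j then 4 else 0) : ∑ a, msC (N a) = 1 := by
  ext i j
  have h1 : ∑ a, (N a i j : ℂ) = if i = j then 4 else 0 := by exact_mod_cast h i j
  rw [Matrix.sum_apply]
  simp only [msC]
  rw [← Finset.mul_sum, h1, Matrix.one_apply]
  split_ifs <;> norm_num

/-- The maximally entangled state. -/
noncomputable def msPsi : Fin 4 × Fin 4 → ℂ := fun p => if p.1 = p.2 then 1 / 2 else 0

theorem msPsi_val (N K : Matrix (Fin 4) (Fin 4) ℤ) :
    (star msPsi ⬝ᵥ ((msC N ⊗ₖ msC K) *ᵥ msPsi)).re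
      = 1 / 64 * ((∑ i, ∑ j, N i j * K i j : ℤ) : ℝ) := by
  have : star msPsi ⬝ᵥ ((msC N ⊗ₖ msC K) *ᵥ msPsi)
      = ((1 / 64 * ((∑ i, ∑ j, N i j * K i j : ℤ) : ℝ) : ℝ) : ℂ) := by
    simp only [dotProduct, mulVec, Fintype.sum_prod_type, kroneckerMap_apply, msPsi, msC,
      Pi.star_apply, apply_ite star, star_zero, ite_mul, mul_ite, zero_mul, mul_zero,
      Finset.sum_ite_eq, Finset.mem_univ, if_true, star_div₀, star_one, star_ofNat]
    push_cast
    simp only [Finset.mul_sum]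
    refine Finset.sum_congr rfl fun i _ => Finset.sum_congr rfl fun j _ => ?_
    ring
  rw [this, Complex.ofReal_re]

theorem ms_total : ∑ x : Fin 3, ∑ y : Fin 3, ∑ a : EvenT, ∑ b : OddT,
    (if a.1 y = b.1 x then (1 : ℤ) else 0) * ∑ i, ∑ j, msN x a i j * msK y b i j = 576 := by
  decide +kernel

/-- The entangled value of the Mermin–Peres Magic Square game equals `1`: there exist
finite dimensions `dA, dB`, a unit vector `ψ ∈ ℂ^{dA} ⊗ ℂ^{dB}`, and POVMs
`{P x a}_a` on `ℂ^{dA}` for each row `x` and `{Q y b}_b` on `ℂ^{dB}` for each column `y`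
such that the expected winning probability
`∑_{x,y} (1/9) ∑_{a,b} V(a,b,x,y) ⟨ψ| P x a ⊗ Q y b |ψ⟩` equals `1`,
where the winning predicate is `a y = b x`. -/
theorem ms_entangled_value_one :
    ∃ (dA dB : ℕ) (ψ : Fin dA × Fin dB → ℂ)
      (P : Fin 3 → EvenT → Matrix (Fin dA) (Fin dA) ℂ)
      (Q : Fin 3 → OddT → Matrix (Fin dB) (Fin dB) ℂ),
      star ψ ⬝ᵥ ψ = 1 ∧
      (∀ x a, (P x a).PosSemidef) ∧ (∀ x, ∑ a, P x a = 1) ∧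
      (∀ y b, (Q y b).PosSemidef) ∧ (∀ y, ∑ b, Q y b = 1) ∧
      ∑ x : Fin 3, ∑ y : Fin 3, (1 / 9 : ℝ) * ∑ a : EvenT, ∑ b : OddT,
        (if a.1 y = b.1 x then (1 : ℝ) else 0) *
          (star ψ ⬝ᵥ ((P x a ⊗ₖ Q y b) *ᵥ ψ)).re = 1 := by
  refine ⟨4, 4, msPsi, fun x a => msC (msN x a), fun y b => msC (msK y b), ?_, ?_, ?_, ?_, ?_, ?_⟩
  · simp only [dotProduct, Fintype.sum_prod_type, msPsi, Pi.star_apply, apply_ite star,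
      star_zero, ite_mul, mul_ite, zero_mul, mul_zero, Finset.sum_ite_eq, Finset.mem_univ,
      if_true, star_div₀, star_one, star_ofNat]
    norm_num
  · intro x a
    refine msC_psd _ ?_
    revert x a
    decide +kernel
  · intro x
    refine msC_sum _ ?_
    revert x
    decide +kernel
  · intro y b
    refine msC_psd _ ?_
    revert y b
    decide +kernel
  · intro y
    refine msC_sum _ ?_
    revert y
    decide +kernel
  · have h := congrArg (fun z : ℤ => (1 / 576 : ℝ) * (z : ℝ)) ms_total
    simp only [Int.cast_sum, Int.cast_mul, Int.cast_ite, Int.cast_one, Int.cast_zero,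
      Int.cast_ofNat] at h
    rw [show (1 / 576 : ℝ) * 576 = 1 by norm_num] at h
    refine Eq.trans ?_ h
    simp only [msPsi_val, Finset.mul_sum, Int.cast_sum, Int.cast_mul]
    refine Finset.sum_congr rfl fun x _ => Finset.sum_congr rfl fun y _ =>
      Finset.sum_congr rfl fun a _ => Finset.sum_congr rfl fun b _ =>
      Finset.sum_congr rfl fun i _ => Finset.sum_congr rfl fun j _ => ?_
    ring
end
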